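/- For all n ≥ 2, m ≥ 0 and pairwise distinct general atoms R₁,…,R_m, S₁,…,Sₙ, the formula (R₁∧…∧R_m → S₁) ∧ … ∧ (R₁∧…∧R_m → Sₙ) → (R₁∧…∧R_m → S₁⊓…⊓Sₙ) is provable in CL2. -/

import Mathlib

/-- CL2-formulas: logical atoms ⊤/⊥, elementary atoms, general atoms,
negation, n-ary ∧, ∨, ⊓, ⊔ (arities other than ≥2 never arise in derivations
of proper formulas). -/
inductive CL2 : Type where
  | top : CL2
  | bot : CL2
  | elem : Nat → CL2
  | gen : Nat → CL2
  | neg : CL2 → CL2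
  | land : List CL2 → CL2
  | lor : List CL2 → CL2
  | chand : List CL2 → CL2
  | chor : List CL2 → CL2

namespace CL2

/-- Elementarization (with a polarity parameter): surface ⊓ becomes ⊤, surface ⊔
becomes ⊥, positive surface general atoms become ⊥, negative ones ⊤. -/
def elz (pos : Bool) : CL2 → CL2
  | top => top
  | bot => bot
  | elem n => elem n
  | gen _ => if pos then bot else top
  | neg F => neg (elz (!pos) F)
  | land l => land (l.attach.map (fun x => elz pos x.1))
  | lor l => lor (l.attach.map (fun x => elz pos x.1))
  | chand _ => top
  | chor _ => bot
termination_by F => sizeOf F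
decreasing_by
  all_goals simp_wf
  all_goals first
    | omega
    | (have h := List.sizeOf_lt_of_mem x.2; omega)

/-- Classical evaluation (used on elementarizations, which contain no
general atoms and no ⊓/⊔). -/
def eval (v : Nat → Bool) : CL2 → Bool
  | top => true
  | bot => false
  | elem n => v n
  | gen _ => false
  | neg F => !(eval v F)
  | land l => (l.attach.map (fun x => eval v x.1)).all id
  | lor l => (l.attach.map (fun x => eval v x.1)).any id
  | chand _ => true
  | chor _ => false
termination_by F => sizeOf F
decreasing_by
  all_goals simp_wf
  all_goals first
    | omega
    | (have h := List.sizeOf_lt_of_mem x.2; omega)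

/-- F is stable iff its elementarization is a classical tautology. -/
def Stable (F : CL2) : Prop := ∀ v : Nat → Bool, eval v (elz true F) = true

/-- Whether the elementary atom `p` occurs (anywhere) in a formula. -/
def elemOccurs (p : Nat) : CL2 → Bool
  | top => false
  | bot => false
  | elem n => n == p
  | gen _ => false
  | neg F => elemOccurs p F
  | land l => (l.attach.map (fun x => elemOccurs p x.1)).any id
  | lor l => (l.attach.map (fun x => elemOccurs p x.1)).any id
  | chand l => (l.attach.map (fun x => elemOccurs p x.1)).any id
  | chor l => (l.attach.map (fun x => elemOccurs p x.1)).any id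
termination_by F => sizeOf F
decreasing_by
  all_goals simp_wf
  all_goals first
    | omega
    | (have h := List.sizeOf_lt_of_mem x.2; omega)

end CL2

/-- One-hole surface contexts: the hole is not in the scope of ⊓ or ⊔. -/
inductive SCtx : Type where
  | hole : SCtx
  | neg : SCtx → SCtx
  | land : List CL2 → SCtx → List CL2 → SCtx
  | lor : List CL2 → SCtx → List CL2 → SCtx

namespace SCtx

def fill : SCtx → CL2 → CL2
  | hole, F => F
  | neg C, F => CL2.neg (fill C F)
  | land l C r, F => CL2.land (l ++ fill C F :: r)
  | lor l C r, F => CL2.lor (l ++ fill C F :: r)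

/-- Number of negations the hole is in the scope of. -/
def negCount : SCtx → Nat
  | hole => 0
  | neg C => negCount C + 1
  | land _ C _ => negCount C
  | lor _ C _ => negCount C

end SCtx

/-- Two-hole surface contexts (the two holes are distinct surface occurrences,
so their least common ancestor is an ∧- or ∨-node). -/
inductive DCtx : Type where
  | neg : DCtx → DCtx
  | land : List CL2 → DCtx → List CL2 → DCtx
  | lor : List CL2 → DCtx → List CL2 → DCtx
  | landS : List CL2 → SCtx → List CL2 → SCtx → List CL2 → DCtx
  | lorS : List CL2 → SCtx → List CL2 → SCtx → List CL2 → DCtx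

namespace DCtx

def fill2 : DCtx → CL2 → CL2 → CL2
  | neg D, A, B => CL2.neg (fill2 D A B)
  | land l D r, A, B => CL2.land (l ++ fill2 D A B :: r)
  | lor l D r, A, B => CL2.lor (l ++ fill2 D A B :: r)
  | landS l C1 m C2 r, A, B => CL2.land (l ++ C1.fill A :: m ++ C2.fill B :: r)
  | lorS l C1 m C2 r, A, B => CL2.lor (l ++ C1.fill A :: m ++ C2.fill B :: r)

def negCount1 : DCtx → Nat
  | neg D => negCount1 D + 1
  | land _ D _ => negCount1 D
  | lor _ D _ => negCount1 D
  | landS _ C1 _ _ _ => C1.negCount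
  | lorS _ C1 _ _ _ => C1.negCount

def negCount2 : DCtx → Nat
  | neg D => negCount2 D + 1
  | land _ D _ => negCount2 D
  | lor _ D _ => negCount2 D
  | landS _ _ _ C2 _ => C2.negCount
  | lorS _ _ _ C2 _ => C2.negCount

end DCtx

/-- The premises of Rule (a) with conclusion `F`: results of replacing a positive
surface occurrence of a ⊓-subformula, or a negative surface occurrence of a
⊔-subformula, by one of its components. -/
def PremiseA (F H : CL2) : Prop :=
  ∃ (C : SCtx) (Gs : List CL2) (i : Fin Gs.length),
    (Even C.negCount ∧ F = C.fill (CL2.chand Gs) ∧ H = C.fill (Gs.get i)) ∨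
    (Odd C.negCount ∧ F = C.fill (CL2.chor Gs) ∧ H = C.fill (Gs.get i))

/-- The premise of Rule (b): `H` results from replacing in `F` a negative surface
occurrence of a ⊓-subformula, or a positive surface occurrence of a ⊔-subformula,
by one of its components. -/
def PremiseB (F H : CL2) : Prop :=
  ∃ (C : SCtx) (Gs : List CL2) (i : Fin Gs.length),
    (Odd C.negCount ∧ F = C.fill (CL2.chand Gs) ∧ H = C.fill (Gs.get i)) ∨
    (Even C.negCount ∧ F = C.fill (CL2.chor Gs) ∧ H = C.fill (Gs.get i))

/-- The premise of Rule (c): `H` results from replacing in `F` two — one positive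
and one negative — surface occurrences of a general atom by an elementary atom
not occurring in `F`. -/
def PremiseC (F H : CL2) : Prop :=
  ∃ (D : DCtx) (P p : Nat),
    F = D.fill2 (CL2.gen P) (CL2.gen P) ∧
    H = D.fill2 (CL2.elem p) (CL2.elem p) ∧
    ((Even D.negCount1 ∧ Odd D.negCount2) ∨ (Odd D.negCount1 ∧ Even D.negCount2)) ∧
    CL2.elemOccurs p F = false

/-- CL2-provability. -/
inductive Provable : CL2 → Prop where
  | ruleA (F : CL2) : CL2.Stable F → (∀ H, PremiseA F H → Provable H) → Provable F
  | ruleB (F H : CL2) : PremiseB F H → Provable H → Provable F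
  | ruleC (F H : CL2) : PremiseC F H → Provable H → Provable F

/-- Implication: F → G abbreviates ¬F ∨ G. -/
def CL2.imp (F G : CL2) : CL2 := CL2.lor [CL2.neg F, G]

/-- `conjImp [F₁,…,Fₙ] T` is F₁∧…∧Fₙ → T, with the conventions that for n = 1 it
is F₁ → T and for n = 0 it is T. -/
def conjImp (l : List CL2) (t : CL2) : CL2 :=
  match l with
  | [] => t
  | [f] => CL2.imp f t
  | l => CL2.imp (CL2.land l) t

/-- `conj1 [F₁,…,Fₙ]` is F₁∧…∧Fₙ, with the convention that for n = 1 it is F₁. -/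
def conj1 (l : List CL2) : CL2 :=
  match l with
  | [f] => f
  | l => CL2.land l

namespace CL2

lemma elz_land (b : Bool) (l : List CL2) : elz b (land l) = land (l.map (elz b)) := by
  simp [elz]

lemma elz_lor (b : Bool) (l : List CL2) : elz b (lor l) = lor (l.map (elz b)) := by
  simp [elz]

lemma eval_land (v : Nat → Bool) (l : List CL2) : eval v (land l) = l.all (eval v) := by
  simp [eval]

lemma eval_lor (v : Nat → Bool) (l : List CL2) : eval v (lor l) = l.any (eval v) := by
  simp [eval]

/-- Only finitely many elementary atoms occur in a formula. -/
lemma finite_elemOccurs : ∀ F : CL2, {p | elemOccurs p F = true}.Finite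
  | top => by simp [elemOccurs]
  | bot => by simp [elemOccurs]
  | elem n => by simp [elemOccurs]
  | gen _ => by simp [elemOccurs]
  | neg F => by simpa [elemOccurs] using finite_elemOccurs F
  | land l | lor l | chand l | chor l => by
    refine (l.finite_toSet.biUnion fun x hx => ?_).subset
      (s := ⋃ x ∈ {x | x ∈ l}, {p | elemOccurs p x = true}) ?_
    · have : sizeOf x < sizeOf l := List.sizeOf_lt_of_mem hx
      exact finite_elemOccurs x
    · intro p hp
      simpa [elemOccurs] using hp
termination_by F => sizeOf F

lemma exists_fresh (F : CL2) : ∃ p, elemOccurs p F = false := by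
  obtain ⟨p, hp⟩ := (finite_elemOccurs F).exists_notMem
  exact ⟨p, by simpa using hp⟩

/-- Formulas without surface occurrences of ⊓ and ⊔. -/
inductive ChoiceFree : CL2 → Prop where
  | elem (n : Nat) : ChoiceFree (elem n)
  | gen (n : Nat) : ChoiceFree (gen n)
  | neg {F : CL2} : ChoiceFree F → ChoiceFree (neg F)
  | land {l : List CL2} : (∀ F ∈ l, ChoiceFree F) → ChoiceFree (land l)
  | lor {l : List CL2} : (∀ F ∈ l, ChoiceFree F) → ChoiceFree (lor l)

lemma not_choiceFree_chand (l : List CL2) : ¬ ChoiceFree (chand l) := nofun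

lemma not_choiceFree_chor (l : List CL2) : ¬ ChoiceFree (chor l) := nofun

lemma ChoiceFree.of_fill {C : SCtx} {X : CL2} (h : ChoiceFree (C.fill X)) : ChoiceFree X := by
  induction C with
  | hole => exact h
  | neg C ih => cases h with | neg h => exact ih h
  | land l C r ih => cases h with | land h => exact ih (h _ (by simp))
  | lor l C r ih => cases h with | lor h => exact ih (h _ (by simp))

lemma ChoiceFree.not_premiseA {F H : CL2} (hF : ChoiceFree F) : ¬ PremiseA F H := by
  rintro ⟨C, Gs, i, ⟨-, rfl, -⟩ | ⟨-, rfl, -⟩⟩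
  · exact not_choiceFree_chand _ hF.of_fill
  · exact not_choiceFree_chor _ hF.of_fill

lemma ChoiceFree.imp {F G : CL2} (hF : ChoiceFree F) (hG : ChoiceFree G) :
    ChoiceFree (CL2.imp F G) :=
  .lor (by simpa using ⟨hF.neg, hG⟩)

lemma ChoiceFree.conjImp {l : List CL2} {t : CL2} (hl : ∀ F ∈ l, ChoiceFree F)
    (ht : ChoiceFree t) : ChoiceFree (conjImp l t) := by
  match l with
  | [] => exact ht
  | [f] => exact .imp (hl f (by simp)) ht
  | f :: g :: l => exact .imp (.land hl) ht

end CL2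

open CL2

/-- A surface occurrence in `F → G` of a formula with surface choice operators lies in `G`,
provided `F` is free of such operators and the occurrence is not the whole formula. -/
lemma SCtx.fill_eq_imp {C : SCtx} {X F G : CL2} (hF : ChoiceFree F) (hX : ¬ ChoiceFree X)
    (hne : X ≠ imp F G) (h : C.fill X = imp F G) :
    ∃ C' : SCtx, C = .lor [CL2.neg F] C' [] ∧ C'.fill X = G := by
  cases C with
  | hole => exact absurd h hne
  | neg C => cases h
  | land l C r => cases h
  | lor l C r =>
    simp only [SCtx.fill, imp, CL2.lor.injEq] at h
    rcases l with _ | ⟨a, _ | ⟨b, l⟩⟩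
    · have h' : C.fill X = CL2.neg F := by simp_all
      exact absurd (h' ▸ hF.neg : ChoiceFree (C.fill X)).of_fill hX
    · simp only [List.cons_append, List.nil_append, List.cons.injEq] at h
      obtain ⟨rfl, h, rfl⟩ := h
      exact ⟨C, rfl, h⟩
    · simp at h

lemma SCtx.fill_eq_chand {C : SCtx} {X : CL2} {l : List CL2} (h : C.fill X = CL2.chand l) :
    C = .hole := by
  cases C <;> first | rfl | cases h

/-- The consequent of `conjImp` is a surface occurrence. -/
lemma exists_ctx_consequent (l : List CL2) :
    ∃ C : SCtx, ∀ t, C.fill t = conjImp l t := by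
  match l with
  | [] => exact ⟨.hole, fun _ => rfl⟩
  | [f] => exact ⟨.lor [.neg f] .hole [], fun _ => rfl⟩
  | f :: g :: l => exact ⟨.lor [.neg (.land (f :: g :: l))] .hole [], fun _ => rfl⟩

/-- The antecedents of `conjImp` are surface occurrences. -/
lemma exists_ctx_antecedent (a b : List CL2) (t : CL2) :
    ∃ C : SCtx, ∀ x, C.fill x = conjImp (a ++ x :: b) t := by
  match a, b with
  | [], [] => exact ⟨.lor [] (.neg .hole) [t], fun _ => rfl⟩
  | [], g :: b => exact ⟨.lor [] (.neg (.land [] .hole (g :: b))) [t], fun _ => rfl⟩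
  | [f], b => exact ⟨.lor [] (.neg (.land [f] .hole b)) [t], fun _ => rfl⟩
  | f :: g :: a, b =>
    exact ⟨.lor [] (.neg (.land (f :: g :: a) .hole b)) [t], fun _ => rfl⟩

/-- The only surface choice operator of `conjImp l (chand Ss)` is its consequent. -/
lemma fill_eq_conjImp_chand {C : SCtx} {X : CL2} {l Ss : List CL2}
    (hl : ∀ F ∈ l, ChoiceFree F) (hX : ¬ ChoiceFree X) (hlor : ∀ l, X ≠ CL2.lor l)
    (h : C.fill X = conjImp l (CL2.chand Ss)) :
    X = CL2.chand Ss ∧ ∀ t, C.fill t = conjImp l t := by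
  match l with
  | [] =>
    obtain rfl := SCtx.fill_eq_chand h
    exact ⟨h, fun _ => rfl⟩
  | [f] =>
    obtain ⟨C, rfl, hC⟩ := SCtx.fill_eq_imp (hl f (by simp)) hX (hlor _) h
    obtain rfl := SCtx.fill_eq_chand hC
    exact ⟨hC, fun _ => rfl⟩
  | f :: g :: l =>
    obtain ⟨C, rfl, hC⟩ := SCtx.fill_eq_imp (.land hl) hX (hlor _) h
    obtain rfl := SCtx.fill_eq_chand hC
    exact ⟨hC, fun _ => rfl⟩

/-- Rule (c) matching the same general atom in a conjunct and in the conclusion. -/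
lemma provable_imp_of_fill_elem (l r : List CL2) (C : SCtx) (P : Nat)
    (h : ∀ p, Provable (imp (land (l ++ C.fill (elem p) :: r)) (C.fill (elem p)))) :
    Provable (imp (land (l ++ C.fill (gen P) :: r)) (C.fill (gen P))) := by
  obtain ⟨p, hp⟩ := exists_fresh (imp (land (l ++ C.fill (gen P) :: r)) (C.fill (gen P)))
  refine .ruleC _ _ ⟨.lorS [] (.neg (.land l C r)) [] C [], P, p, rfl, rfl, ?_, hp⟩ (h p)
  simp only [DCtx.negCount1, DCtx.negCount2, SCtx.negCount]
  rcases Nat.even_or_odd C.negCount with h | h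
  · exact .inr ⟨h.add_one, h⟩
  · exact .inl ⟨h.add_one, h⟩

lemma elz_conjImp_elem (b : Bool) (es : List Nat) (q : Nat) :
    elz b (conjImp (es.map elem) (elem q)) = conjImp (es.map elem) (elem q) := by
  match es with
  | [] => simp [conjImp, elz]
  | [e] => simp [conjImp, imp, elz]
  | e :: f :: es => simp [conjImp, imp, elz_land, elz_lor, elz, Function.comp_def]

lemma provable_imp_conjImp_elem {l r : List CL2} (hl : ∀ F ∈ l, ChoiceFree F)
    (hr : ∀ F ∈ r, ChoiceFree F) (es : List Nat) (q : Nat) :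
    Provable (imp (land (l ++ conjImp (es.map elem) (elem q) :: r))
      (conjImp (es.map elem) (elem q))) := by
  have hX : ChoiceFree (conjImp (es.map elem) (elem q)) :=
    .conjImp (by simpa using fun e _ => .elem e) (.elem q)
  refine .ruleA _ (fun v => ?_) fun H hH => absurd hH (ChoiceFree.not_premiseA ?_)
  · simp only [imp, elz_lor, elz_land, elz, eval_lor, eval_land, eval, elz_conjImp_elem,
      List.map_append, List.map_cons, List.map_nil, List.all_append, List.all_cons,
      List.any_cons, List.any_nil, Bool.not_true]
    cases eval v (conjImp (es.map elem) (elem q)) <;> simp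
  · refine .imp (.land fun F hF => ?_) hX
    rcases List.mem_append.1 hF with h | h
    · exact hl F h
    · rcases List.mem_cons.1 h with rfl | h
      · exact hX
      · exact hr F h

lemma provable_imp_conjImp_gen {l r : List CL2} (hl : ∀ F ∈ l, ChoiceFree F)
    (hr : ∀ F ∈ r, ChoiceFree F) (q : Nat) (gs es : List Nat) :
    Provable (imp (land (l ++ conjImp (es.map elem ++ gs.map gen) (elem q) :: r))
      (conjImp (es.map elem ++ gs.map gen) (elem q))) := by
  induction gs generalizing es with
  | nil => simpa using provable_imp_conjImp_elem hl hr es q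
  | cons g gs ih =>
    obtain ⟨C, hC⟩ := exists_ctx_antecedent (es.map elem) (gs.map gen) (elem q)
    rw [List.map_cons, ← hC]
    refine provable_imp_of_fill_elem l r C g fun p => ?_
    rw [hC]
    simpa using ih (es ++ [p])

/-- A conjunct `R₁∧…∧R_m → S` implies itself. -/
lemma provable_imp_conjImp {l r : List CL2} (hl : ∀ F ∈ l, ChoiceFree F)
    (hr : ∀ F ∈ r, ChoiceFree F) (s : Nat) (gs : List Nat) :
    Provable (imp (land (l ++ conjImp (gs.map gen) (gen s) :: r))
      (conjImp (gs.map gen) (gen s))) := by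
  obtain ⟨C, hC⟩ := exists_ctx_consequent (gs.map gen)
  rw [← hC]
  refine provable_imp_of_fill_elem l r C s fun p => ?_
  rw [hC]
  simpa using provable_imp_conjImp_gen hl hr p gs []

lemma stable_imp_conjImp_chand (F : CL2) (l Ss : List CL2) :
    Stable (imp F (conjImp l (chand Ss))) := by
  intro v
  match l with
  | [] => simp [conjImp, imp, elz, eval]
  | [f] => simp [conjImp, imp, elz, eval]
  | f :: g :: l => simp [conjImp, imp, elz, eval]

/-- Lemma 8(h): for all n ≥ 2, m ≥ 0 and pairwise distinct general atoms
R₁,…,R_m, S₁,…,Sₙ, the formula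
(R₁∧…∧R_m → S₁) ∧ … ∧ (R₁∧…∧R_m → Sₙ) → (R₁∧…∧R_m → S₁⊓…⊓Sₙ) is provable in CL2. -/
theorem cl2_provable_h (n m : Nat) (hn : 2 ≤ n) (R : Fin m → Nat) (S : Fin n → Nat)
    (hdist : (List.ofFn R ++ List.ofFn S).Nodup) :
    Provable (CL2.imp
      (CL2.land (List.ofFn fun i => conjImp ((List.ofFn R).map CL2.gen) (CL2.gen (S i))))
      (conjImp ((List.ofFn R).map CL2.gen) (CL2.chand ((List.ofFn S).map CL2.gen)))) := by
  have hR : ∀ F ∈ (List.ofFn R).map CL2.gen, ChoiceFree F := by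
    simpa using fun i => ChoiceFree.gen (R i)
  have hA : ∀ F ∈ List.ofFn fun i => conjImp ((List.ofFn R).map CL2.gen) (CL2.gen (S i)),
      ChoiceFree F := by
    intro F hF
    obtain ⟨i, rfl⟩ := (List.mem_ofFn' _ _).1 hF
    exact .conjImp hR (.gen _)
  refine .ruleA _ (stable_imp_conjImp_chand _ _ _) ?_
  rintro H ⟨C, Gs, i, ⟨-, hF, rfl⟩ | ⟨-, hF, -⟩⟩
  · obtain ⟨C, rfl, hC⟩ :=
      SCtx.fill_eq_imp (.land hA) (not_choiceFree_chand Gs) nofun hF.symm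
    obtain ⟨hGs, hfill⟩ := fill_eq_conjImp_chand hR (not_choiceFree_chand Gs) nofun hC
    obtain rfl := CL2.chand.inj hGs
    obtain ⟨k, hk⟩ : ∃ k, CL2.gen (S k) = ((List.ofFn S).map CL2.gen).get i :=
      ⟨⟨i, by simpa using i.2⟩, by simp⟩
    rw [← hk]
    obtain ⟨l, r, hlr⟩ := List.append_of_mem
      ((List.mem_ofFn' (fun i => conjImp ((List.ofFn R).map CL2.gen) (CL2.gen (S i))) _).2
        ⟨k, rfl⟩)
    rw [hlr] at hA ⊢
    have hl : ∀ F ∈ l, ChoiceFree F := fun F h => hA F (List.mem_append_left _ h)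
    have hr : ∀ F ∈ r, ChoiceFree F := fun F h =>
      hA F (List.mem_append_right _ (List.mem_cons_of_mem _ h))
    rw [SCtx.fill, hfill]
    exact provable_imp_conjImp hl hr (S k) (List.ofFn R)
  · obtain ⟨C, rfl, hC⟩ :=
      SCtx.fill_eq_imp (.land hA) (not_choiceFree_chor Gs) nofun hF.symm
    exact absurd (fill_eq_conjImp_chand hR (not_choiceFree_chor Gs) nofun hC).1 nofun
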